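/- arXiv:1809.10774 — 5 statements merged into one kernel-verified Lean document; each statement's English description precedes it below -/
import Mathlib

section
/- Let n₁ ≥ n₂ be integers and let M be a 2×2 matrix over ℂ((z)) with det M ≠ 0 and v(det M) = n₁ + n₂. Then the following are equivalent: (a) there exist matrices A, B ∈ GL₂(ℂ⟦z⟧) (2×2 matrices over ℂ⟦z⟧ whose determinants are units of ℂ⟦z⟧) and integers m₁ ≥ m₂ with m₁ + m₂ = n₁ + n₂ and m₂ ≥ n₂ such that M = A·diag(z^{m₁}, z^{m₂})·B; (b) every entry of M lies in z^{n₂}ℂ⟦z⟧. -/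
/-- The generator `z` of `ℂ⟦z⟧`, viewed inside the field of Laurent series `ℂ((z))`. -/
noncomputable def z : LaurentSeries ℂ := ((PowerSeries.X : PowerSeries ℂ) : LaurentSeries ℂ)

/-- A `2×2` matrix over a commutative ring whose lower right entry divides all the others is
equivalent to a diagonal matrix with that entry in the lower right corner. -/
theorem exists_eq_mul_diagonal_mul_of_dvd {R : Type*} [CommRing R]
    (P : Matrix (Fin 2) (Fin 2) R) (hP : ∀ i j, P 1 1 ∣ P i j) :
    ∃ (A B : Matrix (Fin 2) (Fin 2) R) (s : R), IsUnit A.det ∧ IsUnit B.det ∧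
      P = A * !![P 1 1 * s, 0; 0, P 1 1] * B := by
  obtain ⟨t, ht⟩ := hP 0 0
  obtain ⟨u, hu⟩ := hP 0 1
  obtain ⟨w, hw⟩ := hP 1 0
  refine ⟨!![1, u; 0, 1], !![1, 0; w, 1], t - u * w, by simp, by simp, ?_⟩
  ext i j
  fin_cases i <;> fin_cases j <;> simp [Matrix.mul_apply, ht, hu, hw] <;> ring

/-- In a valuation ring, some entry of a `2×2` matrix divides all the others. -/
theorem exists_entry_dvd {R : Type*} [CommRing R] [IsDomain R] [ValuationRing R]
    (P : Matrix (Fin 2) (Fin 2) R) : ∃ i j, ∀ k l, P i j ∣ P k l := by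
  have key (s : Finset (Fin 2 × Fin 2)) (hs : s.Nonempty) :
      ∃ x : Fin 2 × Fin 2, ∀ y ∈ s, P x.1 x.2 ∣ P y.1 y.2 := by
    induction hs using Finset.Nonempty.cons_induction with
    | singleton a => exact ⟨a, by simp⟩
    | cons a s _ _ ih =>
      obtain ⟨x, hx⟩ := ih
      rcases ValuationRing.dvd_total (P x.1 x.2) (P a.1 a.2) with h | h
      · refine ⟨x, fun y hy => ?_⟩
        rcases Finset.mem_cons.1 hy with rfl | hy
        exacts [h, hx y hy]
      · refine ⟨a, fun y hy => ?_⟩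
        rcases Finset.mem_cons.1 hy with rfl | hy
        exacts [dvd_rfl, h.trans (hx y hy)]
  obtain ⟨x, hx⟩ := key Finset.univ Finset.univ_nonempty
  exact ⟨x.1, x.2, fun k l => hx (k, l) (Finset.mem_univ _)⟩

/-- Smith normal form of a `2×2` matrix over a valuation ring. -/
theorem exists_smith_normal_form {R : Type*} [CommRing R] [IsDomain R] [ValuationRing R]
    (P : Matrix (Fin 2) (Fin 2) R) :
    ∃ (A B : Matrix (Fin 2) (Fin 2) R) (d s : R), IsUnit A.det ∧ IsUnit B.det ∧
      P = A * !![d * s, 0; 0, d] * B := by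
  obtain ⟨i, j, hij⟩ := exists_entry_dvd P
  obtain ⟨A, B, s, hA, hB, hP⟩ := exists_eq_mul_diagonal_mul_of_dvd
    (P.submatrix (Equiv.swap i 1) (Equiv.swap j 1)) fun k l => by simpa using hij _ _
  refine ⟨A.submatrix (Equiv.swap i 1) id, B.submatrix id (Equiv.swap j 1), P i j, s, ?_, ?_, ?_⟩
  · rw [Matrix.det_permute]
    exact ((Equiv.Perm.sign _).isUnit.map (Int.castRingHom R)).mul hA
  · rw [Matrix.det_permute']
    exact ((Equiv.Perm.sign _).isUnit.map (Int.castRingHom R)).mul hB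
  · have := congrArg (fun Q => Q.submatrix (Equiv.swap i 1) (Equiv.swap j 1)) hP
    ext k l
    simpa [Matrix.mul_apply] using congrFun (congrFun this k) l

open PowerSeries in
/-- A `2×2` matrix over `k⟦X⟧` with nonzero determinant is equivalent to a diagonal matrix of
powers of `X`. -/
theorem PowerSeries.exists_eq_mul_X_pow_mul {k : Type*} [Field k]
    (P : Matrix (Fin 2) (Fin 2) k⟦X⟧) (hP : P.det ≠ 0) :
    ∃ (A B : Matrix (Fin 2) (Fin 2) k⟦X⟧) (a b : ℕ), IsUnit A.det ∧ IsUnit B.det ∧ b ≤ a ∧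
      P = A * !![X ^ a, 0; 0, X ^ b] * B := by
  obtain ⟨A, B, d, s, hA, hB, rfl⟩ := exists_smith_normal_form P
  have hd : d ≠ 0 := by rintro rfl; simp at hP
  have hs : s ≠ 0 := by rintro rfl; simp at hP
  obtain ⟨b, u, rfl⟩ := IsDiscreteValuationRing.eq_unit_mul_pow_irreducible hd X_irreducible
  obtain ⟨c, v, rfl⟩ := IsDiscreteValuationRing.eq_unit_mul_pow_irreducible hs X_irreducible
  refine ⟨A * !![(u * v : k⟦X⟧), 0; 0, u], B, b + c, b, ?_, hB, by omega, ?_⟩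
  · simpa using hA
  · rw [Matrix.mul_assoc A !![_, _; _, _] !![_, _; _, _], Matrix.mul_fin_two]
    simp only [mul_zero, zero_mul, add_zero, zero_add]
    rw [pow_add, mul_mul_mul_comm]

theorem z_ne_zero : z ≠ 0 := by
  simp [z]

theorem z_zpow_eq_single (n : ℤ) : z ^ n = HahnSeries.single n 1 := by
  rw [z, PowerSeries.coe_X, RatFunc.single_zpow n]

theorem z_pow_eq_coe (n : ℕ) :
    ((PowerSeries.X ^ n : PowerSeries ℂ) : LaurentSeries ℂ) = z ^ n := by
  simp [z]

theorem order_z_zpow (n : ℤ) : (z ^ n).order = n := by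
  rw [z_zpow_eq_single, HahnSeries.order_single one_ne_zero]

theorem order_coe_eq_zero_of_isUnit {p : PowerSeries ℂ} (hp : IsUnit p) :
    (p : LaurentSeries ℂ).order = 0 := by
  have hc : (p : LaurentSeries ℂ).coeff 0 ≠ 0 := by
    have := (hp.map PowerSeries.constantCoeff).ne_zero
    simpa [PowerSeries.coeff_coe] using this
  have hne : (p : LaurentSeries ℂ) ≠ 0 := fun h0 => hc (by simp [h0])
  refine le_antisymm (HahnSeries.order_le_of_coeff_ne_zero hc) ?_
  rw [HahnSeries.le_order_iff_forall hne]
  intro j hj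
  simp [PowerSeries.coeff_coe, hj]

/-- For integers `n₁ ≥ n₂` and a `2×2` matrix `M` over `ℂ((z))` with `det M ≠ 0` and
`v(det M) = n₁ + n₂`, the matrix `M` can be written as `A · diag(z^{m₁}, z^{m₂}) · B` with
`A, B ∈ GL₂(ℂ⟦z⟧)`, `m₁ ≥ m₂`, `m₁ + m₂ = n₁ + n₂` and `m₂ ≥ n₂` if and only if all
entries of `M` lie in `z^{n₂}ℂ⟦z⟧`. -/
theorem schubert_closure_membership (n₁ n₂ : ℤ) (h : n₂ ≤ n₁)
    (M : Matrix (Fin 2) (Fin 2) (LaurentSeries ℂ))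
    (hdet : M.det ≠ 0) (hord : M.det.order = n₁ + n₂) :
    (∃ (A B : Matrix (Fin 2) (Fin 2) (PowerSeries ℂ)) (m₁ m₂ : ℤ),
        IsUnit A.det ∧ IsUnit B.det ∧ m₂ ≤ m₁ ∧ m₁ + m₂ = n₁ + n₂ ∧ n₂ ≤ m₂ ∧
        M = (A.map ((↑) : PowerSeries ℂ → LaurentSeries ℂ)) *
              !![z ^ m₁, 0; 0, z ^ m₂] *
            (B.map ((↑) : PowerSeries ℂ → LaurentSeries ℂ))) ↔
    (∀ i j : Fin 2, ∃ p : PowerSeries ℂ, M i j = z ^ n₂ * (p : LaurentSeries ℂ)) := by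
  constructor
  · rintro ⟨A, B, m₁, m₂, -, -, hm, -, hn, rfl⟩ i j
    obtain ⟨b, rfl⟩ := Int.le.dest hn
    obtain ⟨a, rfl⟩ := Int.le.dest (hn.trans hm)
    refine ⟨A i 0 * PowerSeries.X ^ a * B 0 j + A i 1 * PowerSeries.X ^ b * B 1 j, ?_⟩
    rw [PowerSeries.coe_add, PowerSeries.coe_mul, PowerSeries.coe_mul, PowerSeries.coe_mul,
      PowerSeries.coe_mul, z_pow_eq_coe, z_pow_eq_coe]
    simp only [Matrix.mul_apply, Fin.sum_univ_two, Matrix.map_apply, zpow_add₀ z_ne_zero,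
      zpow_natCast, Matrix.of_apply, Matrix.cons_val', Matrix.cons_val_zero, Matrix.cons_val_one,
      Matrix.cons_val_fin_one]
    ring
  · intro hM
    choose P hP using hM
    let φ : PowerSeries ℂ →+* LaurentSeries ℂ := HahnSeries.ofPowerSeries ℤ ℂ
    have hMP : M = z ^ n₂ • φ.mapMatrix (Matrix.of P) := by
      ext1 i j
      exact hP i j
    have hPdet : (Matrix.of P).det ≠ 0 := by
      intro h0
      rw [hMP, Matrix.det_smul, ← RingHom.map_det, h0] at hdet
      simp at hdet
    obtain ⟨A, B, a, b, hA, hB, hab, hPAB⟩ := PowerSeries.exists_eq_mul_X_pow_mul _ hPdet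
    have hX (n : ℕ) : φ (PowerSeries.X ^ n) = z ^ n := z_pow_eq_coe n
    have hfac : M = φ.mapMatrix A * !![z ^ (n₂ + a), 0; 0, z ^ (n₂ + b)] * φ.mapMatrix B := by
      ext1 i j
      rw [show M i j = z ^ n₂ * φ (P i j) from hP i j, ← Matrix.of_apply P, hPAB]
      simp only [Matrix.mul_apply, Fin.sum_univ_two, RingHom.mapMatrix_apply, Matrix.map_apply,
        zpow_add₀ z_ne_zero, zpow_natCast, Matrix.of_apply, Matrix.cons_val', Matrix.cons_val_zero,
        Matrix.cons_val_one, Matrix.cons_val_fin_one, map_add, map_mul, map_zero, hX]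
      ring
    have hsum : (n₂ + a) + (n₂ + b) = n₁ + n₂ := by
      have hd : M.det = z ^ ((n₂ + a) + (n₂ + b)) * φ (A.det * B.det) := by
        rw [hfac, Matrix.det_mul, Matrix.det_mul, ← RingHom.map_det, ← RingHom.map_det,
          Matrix.det_fin_two_of, map_mul, zpow_add₀ z_ne_zero (n₂ + a)]
        ring
      have hne := hdet
      rw [hd] at hne
      rw [← hord, hd, HahnSeries.order_mul (left_ne_zero_of_mul hne) (right_ne_zero_of_mul hne),
        order_z_zpow, order_coe_eq_zero_of_isUnit (hA.mul hB), add_zero]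
    exact ⟨A, B, n₂ + a, n₂ + b, hA, hB, by omega, hsum, by omega, hfac⟩
end

section
/- Let λ be a nonnegative integer and μ an integer. Let B be the (λ+1)×(λ+1) matrix over the polynomial ring ℂ[a] whose entries are: B_{i,i} = (2i + μ − λ)·a for 0 ≤ i ≤ λ, B_{i−1,i} = i for 1 ≤ i ≤ λ, and 0 otherwise. Regard M = ℂ[a]^{λ+1} as a module over the polynomial ring ℂ[a,c] in two variables, where a acts by scalar multiplication and c acts by the matrix B. Then the ℂ[a,c]-linear map ℂ[a,c] → M sending p to p·e_λ (where e_λ is the last standard basis vector) is surjective, and its kernel is the principal ideal generated by ∏_{i=0}^{λ} (c − (2i + μ − λ)·a); hence M is isomorphic as a ℂ[a,c]-module to ℂ[a,c]/(∏_{i=0}^{λ} (c − (2i + μ − λ)·a)). -/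
open Polynomial

/-- The `(λ+1)×(λ+1)` matrix over `ℂ[a]` with `B_{i,i} = (2i + μ − λ)·a`,
`B_{i−1,i} = i`, and all other entries `0`.  (It is the matrix of the action of
`T(a) = [[0,1],[0,2a]] ∈ gl₂` on `V(λ,μ)` in its monomial basis.) -/
noncomputable def Bmat (l : ℕ) (μ : ℤ) :
    Matrix (Fin (l + 1)) (Fin (l + 1)) (Polynomial ℂ) :=
  Matrix.of fun i j =>
    if i = j then ((2 * (j : ℤ) + μ - l : ℤ) : Polynomial ℂ) * Polynomial.X
    else if (i : ℕ) + 1 = (j : ℕ) then Polynomial.C ((j : ℕ) : ℂ)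
    else 0

open Module in
/-- If `AEval' f` is generated by `e` as an `R[X]`-module, the annihilator of `e` is generated by
the characteristic polynomial of `f`. -/
theorem LinearMap.ker_toSpanSingleton_AEval'_eq_span_charpoly {R M : Type*} [CommRing R]
    [Nontrivial R] [AddCommGroup M] [Module R M] [Module.Free R M] [Module.Finite R M]
    (f : Module.End R M) (e : AEval' f)
    (he : Function.Surjective (LinearMap.toSpanSingleton R[X] (AEval' f) e)) :
    LinearMap.ker (LinearMap.toSpanSingleton R[X] (AEval' f) e) = Ideal.span {f.charpoly} := by
  set ψ := LinearMap.toSpanSingleton R[X] (AEval' f) e with hψ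
  have hmonic := f.charpoly_monic
  have hzero : ∀ q, ψ (f.charpoly * q) = 0 := fun q ↦ by
    apply (AEval'.of f).symm.injective
    simp [hψ, LinearMap.aeval_self_charpoly]
  have hmod : ∀ q, ψ (q %ₘ f.charpoly) = ψ q := fun q ↦ by
    conv_rhs => rw [← modByMonic_add_div q f.charpoly, map_add, hzero, add_zero]
  have hmem : ∀ q, q %ₘ f.charpoly ∈ degreeLT R (finrank R M) := fun q ↦ by
    rw [mem_degreeLT, ← f.charpoly_natDegree, ← degree_eq_natDegree hmonic.ne_zero]
    exact degree_modByMonic_lt q hmonic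
  let φ : degreeLT R (finrank R M) →ₗ[R] AEval' f :=
    ψ.restrictScalars R ∘ₗ (degreeLT R (finrank R M)).subtype
  let ε : AEval' f ≃ₗ[R] degreeLT R (finrank R M) :=
    (AEval'.of f).symm ≪≫ₗ (finBasis R M).equivFun ≪≫ₗ (degreeLTEquiv R (finrank R M)).symm
  have hφ : Function.Injective φ :=
    OrzechProperty.injective_of_surjective_of_injective ε.symm.toLinearMap φ
      ε.symm.injective fun m ↦ by
        obtain ⟨q, rfl⟩ := he m
        exact ⟨⟨_, hmem q⟩, hmod q⟩
  ext p
  rw [LinearMap.mem_ker, Ideal.mem_span_singleton]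
  refine ⟨fun hp ↦ ?_, fun ⟨q, hq⟩ ↦ hq ▸ hzero q⟩
  rw [← modByMonic_eq_zero_iff_dvd hmonic]
  have h0 : (⟨_, hmem p⟩ : degreeLT R (finrank R M)) = 0 :=
    hφ (by rw [map_zero]; exact (hmod p).trans hp)
  exact congrArg Subtype.val h0

theorem Bmat_charpoly (l : ℕ) (μ : ℤ) :
    (Bmat l μ).charpoly = ∏ i ∈ Finset.range (l + 1),
      ((X : ℂ[X][X]) - C (((2 * (i : ℤ) + μ - l : ℤ) : ℂ[X]) * X)) := by
  rw [Matrix.charpoly_of_isUpperTriangular, Finset.prod_range]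
  · simp [Bmat]
  · intro i j hij
    have hij' : (j : ℕ) < i := hij
    rw [Bmat, Matrix.of_apply, if_neg (by rintro rfl; exact hij'.false), if_neg (by omega)]

theorem Bmat_mulVec_single_succ (l : ℕ) (μ : ℤ) (j : Fin l) :
    (Bmat l μ).mulVec (Pi.single j.succ 1) =
      (((2 * (j.succ : ℕ) + μ - l : ℤ) : ℂ[X]) * X) • Pi.single j.succ 1 +
        C ((j.succ : ℕ) : ℂ) • Pi.single j.castSucc 1 := by
  ext1 i
  rw [Matrix.mulVec_single_one, Matrix.col_apply, Bmat, Matrix.of_apply]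
  rcases eq_or_ne i j.succ with rfl | hi
  · simp [j.castSucc_lt_succ.ne']
  · rcases eq_or_ne i j.castSucc with rfl | hi'
    · simp [hi]
    · have : ¬ (i : ℕ) + 1 = (j.succ : ℕ) := fun h ↦ hi' (Fin.ext (by simpa using h))
      rw [if_neg hi, if_neg this]
      simp [hi, hi']

open Module in
/-- The last basis vector generates `ℂ[a]^{λ+1}` as a `ℂ[a][c]`-module. -/
theorem Bmat_toSpanSingleton_surjective (l : ℕ) (μ : ℤ) :
    Function.Surjective (LinearMap.toSpanSingleton ℂ[X][X] (AEval' (Bmat l μ).mulVecLin)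
      (AEval'.of (Bmat l μ).mulVecLin (Pi.single (Fin.last l) 1))) := by
  set f := (Bmat l μ).mulVecLin
  set S := LinearMap.range (LinearMap.toSpanSingleton ℂ[X][X] (AEval' f)
    (AEval'.of f (Pi.single (Fin.last l) 1)))
  have hC : ∀ (r : ℂ[X]) (v : Fin (l + 1) → ℂ[X]), AEval'.of f v ∈ S → AEval'.of f (r • v) ∈ S :=
    fun r v hv ↦ by
      rw [map_smul, ← AEval.C_smul]
      exact S.smul_mem _ hv
  have hbasis : ∀ j : Fin (l + 1), AEval'.of f (Pi.single j 1) ∈ S := fun j ↦ by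
    induction j using Fin.reverseInduction with
    | last => exact ⟨1, by simp⟩
    | cast j ih =>
      have hX : AEval'.of f (f (Pi.single j.succ 1)) ∈ S := by
        rw [← AEval'.X_smul_of]
        exact S.smul_mem _ ih
      rw [show f (Pi.single j.succ 1) = _ from Bmat_mulVec_single_succ l μ j, map_add] at hX
      have h := hC (C ((j.succ : ℕ) : ℂ)⁻¹) _ ((S.add_mem_iff_right (hC _ _ ih)).1 hX)
      rwa [smul_smul, ← C_mul, inv_mul_cancel₀ (Nat.cast_ne_zero.2 j.val.succ_ne_zero), C_1,
        one_smul] at h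
  rw [← LinearMap.range_eq_top, eq_top_iff]
  rintro m -
  obtain ⟨v, rfl⟩ := (AEval'.of f).surjective m
  rw [pi_eq_sum_univ' v, map_sum]
  exact S.sum_mem fun j _ ↦ hC _ _ (hbasis j)

/-- `M = ℂ[a]^{λ+1}`, regarded as a module over `ℂ[a][c]` (≅ `ℂ[a,c]`) with `a` acting as
scalar multiplication and `c` acting by the matrix `B`, is a cyclic module generated by the
last basis vector `e_λ`: the map `ℂ[a][c] → M`, `p ↦ p • e_λ` is surjective, its kernel is
the principal ideal generated by `∏_{i=0}^{λ} (c − (2i + μ − λ)·a)`, and hence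
`M ≅ ℂ[a,c]/(∏_{i=0}^{λ} (c − (2i + μ − λ)·a))` as `ℂ[a,c]`-modules. -/
theorem cyclic_module_structure (l : ℕ) (μ : ℤ) :
    letI N := Module.AEval' ((Bmat l μ).mulVecLin)
    letI e : N := Module.AEval'.of ((Bmat l μ).mulVecLin) (Pi.single (Fin.last l) 1)
    letI ψ : Polynomial (Polynomial ℂ) →ₗ[Polynomial (Polynomial ℂ)] N :=
      LinearMap.toSpanSingleton (Polynomial (Polynomial ℂ)) N e
    letI P : Polynomial (Polynomial ℂ) :=
      ∏ i ∈ Finset.range (l + 1),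
        ((Polynomial.X : Polynomial (Polynomial ℂ)) -
          Polynomial.C (((2 * (i : ℤ) + μ - l : ℤ) : Polynomial ℂ) * Polynomial.X))
    Function.Surjective ψ ∧
    LinearMap.ker ψ = Ideal.span {P} ∧
    Nonempty ((Polynomial (Polynomial ℂ) ⧸ Ideal.span {P}) ≃ₗ[Polynomial (Polynomial ℂ)] N) := by
  have hsurj := Bmat_toSpanSingleton_surjective l μ
  have hker := LinearMap.ker_toSpanSingleton_AEval'_eq_span_charpoly _ _ hsurj
  rw [Matrix.charpoly_mulVecLin, Bmat_charpoly] at hker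
  exact ⟨hsurj, hker, ⟨Submodule.quotEquivOfEq _ _ hker.symm ≪≫ₗ
    LinearMap.quotKerEquivOfSurjective _ hsurj⟩⟩
end

section
/- Let p : ℂ² × ℂ² → ℂ be a polynomial function (i.e., given by evaluating a polynomial in four variables) such that p(g·v, (gᵀ)⁻¹·w) = p(v, w) for every g ∈ GL₂(ℂ) and all v, w ∈ ℂ². Then there exists a polynomial q in one variable over ℂ such that p(v, w) = q(v₁w₁ + v₂w₂) for all v, w ∈ ℂ². -/
open Matrix

/-- A pair `(v, w)` with nonzero pairing `t` lies in the `GL₂`-orbit of `(e₁, t e₁)`. -/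
theorem exists_mulVec_eq_of_pairing_ne_zero {K : Type*} [Field K] (v w : Fin 2 → K)
    (h : v 0 * w 0 + v 1 * w 1 ≠ 0) :
    ∃ g : Matrix (Fin 2) (Fin 2) K, IsUnit g.det ∧ g.mulVec ![1, 0] = v ∧
      (gᵀ)⁻¹.mulVec ![v 0 * w 0 + v 1 * w 1, 0] = w := by
  have hdet : IsUnit (!![v 0, -w 1; v 1, w 0]).det := by
    rw [det_fin_two_of, isUnit_iff_ne_zero]
    convert h using 1
    ring
  refine ⟨!![v 0, -w 1; v 1, w 0], hdet, ?_, ?_⟩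
  · ext i
    fin_cases i <;> simp [mulVec, dotProduct, Fin.sum_univ_two]
  · have hw : ![v 0 * w 0 + v 1 * w 1, 0] = (!![v 0, -w 1; v 1, w 0])ᵀ.mulVec w := by
      ext i
      fin_cases i
      · simp [mulVec, dotProduct, Fin.sum_univ_two]
      · simp [mulVec, dotProduct, Fin.sum_univ_two]
        ring
    rw [hw, mulVec_mulVec, nonsing_inv_mul _ (by rwa [det_transpose]), one_mulVec]

/-- If a polynomial function `p` on `ℂ² × ℂ²` satisfies `p(g·v, (gᵀ)⁻¹·w) = p(v,w)` for all
`g ∈ GL₂(ℂ)`, then `p(v,w) = q(v₁w₁ + v₂w₂)` for some one-variable polynomial `q`. -/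
theorem invariant_polynomials (P : MvPolynomial (Fin 2 ⊕ Fin 2) ℂ)
    (hinv : ∀ g : Matrix (Fin 2) (Fin 2) ℂ, IsUnit g.det → ∀ v w : Fin 2 → ℂ,
      MvPolynomial.eval (Sum.elim (g.mulVec v) ((gᵀ)⁻¹.mulVec w)) P =
        MvPolynomial.eval (Sum.elim v w) P) :
    ∃ q : Polynomial ℂ, ∀ v w : Fin 2 → ℂ,
      MvPolynomial.eval (Sum.elim v w) P = q.eval (v 0 * w 0 + v 1 * w 1) := by
  -- `q` is the restriction of `P` to the slice `t ↦ (e₁, t e₁)`.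
  let q : Polynomial ℂ := MvPolynomial.aeval (Sum.elim ![1, 0] ![Polynomial.X, 0]) P
  have hq (t : ℂ) : q.eval t = MvPolynomial.eval (Sum.elim ![1, 0] ![t, 0]) P := by
    rw [← Polynomial.coe_evalRingHom, MvPolynomial.map_aeval, MvPolynomial.eval,
      MvPolynomial.coe_eval₂Hom, MvPolynomial.coe_eval₂Hom]
    congr 1
    · ext
      simp
    · ext i
      rcases i with i | i <;> fin_cases i <;> simp
  let D : MvPolynomial (Fin 2 ⊕ Fin 2) ℂ :=
    .X (.inl 0) * .X (.inr 0) + .X (.inl 1) * .X (.inr 1)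
  have hD (v w : Fin 2 → ℂ) :
      MvPolynomial.eval (Sum.elim v w) D = v 0 * w 0 + v 1 * w 1 := by
    simp [D]
  have hqD (v w : Fin 2 → ℂ) : MvPolynomial.eval (Sum.elim v w) (Polynomial.aeval D q) =
      q.eval (v 0 * w 0 + v 1 * w 1) := by
    rw [← hD, Polynomial.aeval_def, Polynomial.hom_eval₂, Polynomial.eval]
    congr 1
    ext
    simp
  have hD0 : D ≠ 0 := fun h => by
    simpa [h] using hD ![1, 0] ![1, 0]
  have hmul : D * (P - Polynomial.aeval D q) = 0 := by
    refine MvPolynomial.funext fun x => ?_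
    rw [← Sum.elim_comp_inl_inr x]
    generalize x ∘ Sum.inl = v
    generalize x ∘ Sum.inr = w
    rw [map_mul, map_sub, hD, hqD, map_zero, mul_eq_zero, or_iff_not_imp_left]
    intro h
    obtain ⟨g, hg, hv, hw⟩ := exists_mulVec_eq_of_pairing_ne_zero v w h
    have := hinv g hg ![1, 0] ![v 0 * w 0 + v 1 * w 1, 0]
    rw [hv, hw] at this
    rw [this, hq, sub_self]
  have hP : P = Polynomial.aeval D q :=
    sub_eq_zero.mp ((mul_eq_zero.mp hmul).resolve_left hD0)
  exact ⟨q, fun v w => by rw [← hqD, ← hP]⟩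
end

section
/- Let p : ℂ² × ℂ² → ℂ be a polynomial function such that p(g·v, (gᵀ)⁻¹·w) = p(v, w) for every g ∈ GL₂(ℂ) and all v, w ∈ ℂ². Then the restriction of p to the set Z = {(v,w) ∈ ℂ² × ℂ² : v₁w₁ + v₂w₂ = 0} is constant. -/
open Matrix

/-- On the zero locus of the pairing, simultaneous scaling of `(v, w)` by a nonzero `t` is
realised by an invertible matrix. -/
lemma exists_matrix_scaling_pair {K : Type*} [Field K] {v w : Fin 2 → K}
    (h : v 0 * w 0 + v 1 * w 1 = 0) {t : K} (ht : t ≠ 0) :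
    ∃ g : Matrix (Fin 2) (Fin 2) K, IsUnit g.det ∧ g.mulVec v = t • v ∧
      (gᵀ)⁻¹.mulVec w = t • w := by
  suffices H : ∃ g : Matrix (Fin 2) (Fin 2) K, g.det ≠ 0 ∧ g.mulVec v = t • v ∧
      gᵀ.mulVec (t • w) = w by
    obtain ⟨g, hg, hv, hw⟩ := H
    refine ⟨g, hg.isUnit, hv, ?_⟩
    have hu : IsUnit gᵀ.det := by rw [det_transpose]; exact hg.isUnit
    conv_lhs => rw [← hw]
    rw [mulVec_mulVec, nonsing_inv_mul _ hu, one_mulVec]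
  by_cases hw0 : w = 0
  · subst hw0
    refine ⟨t • 1, by simp [ht], by simp [smul_mulVec], by simp⟩
  obtain ⟨u, hu⟩ : ∃ u : Fin 2 → K, u 0 * w 0 + u 1 * w 1 = 1 := by
    by_cases h0 : w 0 = 0
    · have h1 : w 1 ≠ 0 := fun h1 => hw0 (by ext i; fin_cases i <;> simp [h0, h1])
      exact ⟨![0, (w 1)⁻¹], by simp [h1]⟩
    · exact ⟨![(w 0)⁻¹, 0], by simp [h0]⟩
  have htt : t * t⁻¹ = 1 := mul_inv_cancel₀ ht
  refine ⟨!![t + (t⁻¹ - t) * (u 0 * w 0), (t⁻¹ - t) * (u 0 * w 1);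
    (t⁻¹ - t) * (u 1 * w 0), t + (t⁻¹ - t) * (u 1 * w 1)], ?_, ?_, ?_⟩
  · rw [det_fin_two_of]
    refine ne_of_eq_of_ne (b := 1) ?_ one_ne_zero
    linear_combination t * (t⁻¹ - t) * hu + htt
  · ext i
    fin_cases i <;> simp [mulVec, dotProduct, Fin.sum_univ_two]
    · linear_combination (t⁻¹ - t) * u 0 * h
    · linear_combination (t⁻¹ - t) * u 1 * h
  · ext i
    fin_cases i <;> simp [mulVec, dotProduct, Fin.sum_univ_two]
    · linear_combination (t⁻¹ - t) * t * w 0 * hu + w 0 * htt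
    · linear_combination (t⁻¹ - t) * t * w 1 * hu + w 1 * htt

/-- A polynomial function whose values along the punctured line `t • x`, `t ≠ 0`, all equal its
value at `x` takes that value at the origin too. -/
lemma MvPolynomial.eval_eq_eval_zero_of_smul_invariant {σ : Type*} (P : MvPolynomial σ ℂ)
    (x : σ → ℂ) (h : ∀ t : ℂ, t ≠ 0 → eval (t • x) P = eval x P) :
    eval x P = eval 0 P := by
  have hc : Continuous fun t : ℂ => eval (t • x) P :=
    (MvPolynomial.continuous_eval P).comp (by fun_prop)
  have key := hc.ext_on (dense_compl_singleton (0 : ℂ)) (continuous_const (y := eval x P))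
    fun t ht => h t ht
  simpa using (congrFun key 0).symm

/-- If a polynomial function `p` on `ℂ² × ℂ²` satisfies `p(g·v, (gᵀ)⁻¹·w) = p(v,w)` for all
`g ∈ GL₂(ℂ)`, then `p` is constant on the zero locus `Z = {(v,w) : v₁w₁ + v₂w₂ = 0}`. -/
theorem invariant_constant_on_Z (P : MvPolynomial (Fin 2 ⊕ Fin 2) ℂ)
    (hinv : ∀ g : Matrix (Fin 2) (Fin 2) ℂ, IsUnit g.det → ∀ v w : Fin 2 → ℂ,
      MvPolynomial.eval (Sum.elim (g.mulVec v) ((gᵀ)⁻¹.mulVec w)) P =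
        MvPolynomial.eval (Sum.elim v w) P) :
    ∀ v w v' w' : Fin 2 → ℂ, v 0 * w 0 + v 1 * w 1 = 0 → v' 0 * w' 0 + v' 1 * w' 1 = 0 →
      MvPolynomial.eval (Sum.elim v w) P = MvPolynomial.eval (Sum.elim v' w') P := by
  have eval_eq_zero : ∀ v w : Fin 2 → ℂ, v 0 * w 0 + v 1 * w 1 = 0 →
      MvPolynomial.eval (Sum.elim v w) P = MvPolynomial.eval 0 P := by
    intro v w h
    refine P.eval_eq_eval_zero_of_smul_invariant _ fun t ht => ?_
    obtain ⟨g, hg, hv, hw⟩ := exists_matrix_scaling_pair h ht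
    have hs : t • Sum.elim v w = Sum.elim (t • v) (t • w) := by
      ext i; cases i <;> rfl
    rw [hs, ← hv, ← hw]
    exact hinv g hg v w
  intro v w v' w' h h'
  rw [eval_eq_zero v w h, eval_eq_zero v' w' h']
end

section
/- Let X ⊆ ℂ² × ℂ² be the common zero locus of a family of polynomials in four variables. Suppose X is invariant under the action (v, w) ↦ (g·v, (gᵀ)⁻¹·w) for every g ∈ GL₂(ℂ), and invariant under (v, w) ↦ (v, t·w) for every t ∈ ℂˣ. Then the set {x ∈ ℂ : ((1,0), (x,−1)) ∈ X} is finite if and only if X ⊆ Z, where Z = {(v,w) : v₁w₁ + v₂w₂ = 0}. (In that case the set is contained in {0}.) -/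
open Matrix

/-- A pair `(v, u)` with `⟨v, u⟩ = 1` can be moved, after scaling `u` by `x ≠ 0`, to the slice
point `((1,0), (x,-1))` by an element of `GL₂`. -/
lemma exists_mulVec_eq_slice_point {K : Type*} [Field K] (v u : Fin 2 → K)
    (huv : v 0 * u 0 + v 1 * u 1 = 1) {x : K} (hx : x ≠ 0) :
    ∃ g : Matrix (Fin 2) (Fin 2) K, IsUnit g.det ∧ g.mulVec v = ![1, 0] ∧
      (gᵀ)⁻¹.mulVec (x • u) = ![x, -1] := by
  let g : Matrix (Fin 2) (Fin 2) K := !![u 0 - v 1, u 1 + v 0; -x * v 1, x * v 0]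
  have hdet : g.det = x := by
    simp only [g, det_fin_two_of]
    linear_combination x * huv
  have hunit : IsUnit g.det := hdet ▸ hx.isUnit
  refine ⟨g, hunit, ?_, ?_⟩
  · ext i
    fin_cases i
    · simp [g, mulVec, dotProduct, Fin.sum_univ_two]
      linear_combination huv
    · simp [g, mulVec, dotProduct, Fin.sum_univ_two]
      ring
  · have hw : x • u = gᵀ.mulVec ![x, -1] := by
      ext i
      fin_cases i <;> simp [g, mulVec, dotProduct, Fin.sum_univ_two] <;> ring
    rw [hw, mulVec_mulVec, nonsing_inv_mul _ (by rwa [det_transpose]), one_mulVec]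

/-- Let `X ⊆ ℂ² × ℂ²` be the common zero locus of a family of polynomials, invariant under
`(v,w) ↦ (g·v, (gᵀ)⁻¹·w)` for all `g ∈ GL₂(ℂ)` and under `(v,w) ↦ (v, t·w)` for all
`t ∈ ℂˣ`.  Then `{x : ((1,0),(x,−1)) ∈ X}` is finite iff `X ⊆ Z` where
`Z = {(v,w) : v₁w₁ + v₂w₂ = 0}`; and in that case the set is contained in `{0}`. -/
theorem support_criterion (X : Set ((Fin 2 → ℂ) × (Fin 2 → ℂ)))
    (hzero : ∃ F : Set (MvPolynomial (Fin 2 ⊕ Fin 2) ℂ),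
      X = {vw | ∀ P ∈ F, MvPolynomial.eval (Sum.elim vw.1 vw.2) P = 0})
    (hGL : ∀ g : Matrix (Fin 2) (Fin 2) ℂ, IsUnit g.det → ∀ vw ∈ X,
      (g.mulVec vw.1, (gᵀ)⁻¹.mulVec vw.2) ∈ X)
    (hdil : ∀ t : ℂ, t ≠ 0 → ∀ vw ∈ X, (vw.1, t • vw.2) ∈ X) :
    ({x : ℂ | (![1, 0], ![x, -1]) ∈ X}.Finite ↔
      X ⊆ {vw | vw.1 0 * vw.2 0 + vw.1 1 * vw.2 1 = 0}) ∧
    (X ⊆ {vw | vw.1 0 * vw.2 0 + vw.1 1 * vw.2 1 = 0} →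
      {x : ℂ | (![1, 0], ![x, -1]) ∈ X} ⊆ {0}) := by
  have hslice : X ⊆ {vw | vw.1 0 * vw.2 0 + vw.1 1 * vw.2 1 = 0} →
      {x : ℂ | (![1, 0], ![x, -1]) ∈ X} ⊆ {0} := fun h x hx => by
    simpa using h hx
  refine ⟨⟨fun hfin vw hvw => ?_, fun h => (Set.finite_singleton 0).subset (hslice h)⟩, hslice⟩
  by_contra hc
  rw [Set.mem_ofPred_eq] at hc
  set c := vw.1 0 * vw.2 0 + vw.1 1 * vw.2 1 with hcdef
  refine (Set.finite_singleton (0 : ℂ)).infinite_compl (hfin.subset fun x hx => ?_)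
  have hx : x ≠ 0 := hx
  have huv : vw.1 0 * (c⁻¹ • vw.2) 0 + vw.1 1 * (c⁻¹ • vw.2) 1 = 1 := by
    simp only [Pi.smul_apply, smul_eq_mul]
    rw [← inv_mul_cancel₀ hc]
    linear_combination -c⁻¹ * hcdef
  obtain ⟨g, hg, hv, hw⟩ := exists_mulVec_eq_slice_point vw.1 (c⁻¹ • vw.2) huv hx
  have hmem := hGL g hg _ (hdil x hx _ (hdil c⁻¹ (inv_ne_zero hc) vw hvw))
  rwa [hv, hw] at hmem
end
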